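/- Let λ ≥ 1 be an integer, let G be a finite simple graph with n vertices and minimum degree δ, and let C be a longest cycle in G. If δ ≥ (n+2)/(λ+1) + λ − 2, then either c̄ ≤ min{λ − 1, δ − λ} or c̄ ≥ max{λ + 1, δ − λ + 2}, where c̄ is the length of a longest cycle in the subgraph of G induced by the vertices not on C (with c̄ = 0 when C is a Hamilton cycle). -/

import Mathlib

open SimpleGraph

/-- A cycle `C` is a longest cycle in `G` if no cycle of `G` has greater length. -/
def IsLongestCycle {V : Type*} (G : SimpleGraph V) {v : V} (C : G.Walk v v) : Prop :=
  C.IsCycle ∧ ∀ (u : V) (D : G.Walk u u), D.IsCycle → D.length ≤ C.length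

open scoped Classical in
/-- The length of a longest path in `H`, with the convention that it is `-1`
when `H` has no vertices. -/
noncomputable def pbar {W : Type*} (H : SimpleGraph W) : ℤ :=
  if Nonempty W then
    ((sSup {n : ℕ | ∃ (u v : W) (p : H.Walk u v), p.IsPath ∧ p.length = n} : ℕ) : ℤ)
  else -1

/-- The length of a longest cycle in `H`, where a single vertex counts as a cycle of
length 1 and a single edge as a cycle of length 2, with the convention that it is `0`
when `H` has no vertices. -/
noncomputable def cbar {W : Type*} (H : SimpleGraph W) : ℕ :=
  sSup {n : ℕ | (n = 1 ∧ Nonempty W) ∨ (n = 2 ∧ ∃ u v : W, H.Adj u v) ∨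
    ∃ (v : W) (c : H.Walk v v), c.IsCycle ∧ c.length = n}

/-- `G` is `k`-connected: it has at least `k+1` vertices and remains connected
after the deletion of any set of fewer than `k` vertices. -/
def IsKConnected {V : Type*} [Fintype V] (G : SimpleGraph V) (k : ℕ) : Prop :=
  k + 1 ≤ Fintype.card V ∧
    ∀ S : Finset V, S.card < k → (G.induce ((↑S : Set V)ᶜ)).Connected

/-- `l` lists the vertices of a path of `G` from `a` to `b`. -/
structure IsPathList {W : Type*} (G : SimpleGraph W) (a b : W) (l : List W) : Prop where
  chain : l.IsChain G.Adj
  nodup : l.Nodup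
  head : l.head? = some a
  last : l.getLast? = some b

namespace IsPathList

variable {W : Type*} {G : SimpleGraph W} {a b d : W} {l l₁ l₂ : List W}

theorem singleton (a : W) : IsPathList G a a [a] :=
  ⟨by simp, by simp, by simp, by simp⟩

theorem reverse (h : IsPathList G a b l) : IsPathList G b a l.reverse := by
  refine ⟨?_, by simpa using h.nodup, by simpa using h.last, by simpa using h.head⟩
  rw [List.isChain_reverse]
  exact h.chain.imp fun _ _ => SimpleGraph.Adj.symm

theorem append {a' b' : W} (h₁ : IsPathList G a b l₁) (h₂ : IsPathList G a' b' l₂)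
    (hadj : G.Adj b a') (hd : l₁.Disjoint l₂) : IsPathList G a b' (l₁ ++ l₂) := by
  refine ⟨?_, List.nodup_append'.2 ⟨h₁.nodup, h₂.nodup, hd⟩, ?_, ?_⟩
  · rw [List.isChain_append]
    refine ⟨h₁.chain, h₂.chain, ?_⟩
    rw [h₁.last, h₂.head]
    simpa using hadj
  · simp [h₁.head]
  · simp [h₂.last]

theorem glue (h₁ : IsPathList G a b l₁) (h₂ : IsPathList G b d (b :: l₂))
    (hd : l₁.Disjoint l₂) : IsPathList G a d (l₁ ++ l₂) := by
  cases l₂ with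
  | nil =>
    have : b = d := by simpa using h₂.last
    subst this
    simpa using h₁
  | cons x l =>
    refine h₁.append (a' := x) ⟨?_, ?_, by simp, ?_⟩ ?_ hd
    · exact h₂.chain.tail
    · exact h₂.nodup.of_cons
    · simpa using h₂.last
    · exact h₂.chain.rel

theorem length_pos (h : IsPathList G a b l) : 0 < l.length := by
  rcases l with _ | ⟨x, l⟩
  · simpa using h.head
  · simp

theorem last_mem (h : IsPathList G a b l) : b ∈ l := List.mem_of_getLast? h.last

theorem map {V : Type*} {G' : SimpleGraph V} (f : W → V) (hf : Function.Injective f)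
    (hadj : ∀ x y, G.Adj x y → G'.Adj (f x) (f y)) (h : IsPathList G a b l) :
    IsPathList G' (f a) (f b) (l.map f) := by
  refine ⟨?_, h.nodup.map hf, by simp [h.head], by simp [h.last]⟩
  rw [List.isChain_map]
  exact h.chain.imp hadj

theorem exists_walk (h : IsPathList G a b l) :
    ∃ p : G.Walk a b, p.IsPath ∧ p.support = l := by
  have hne : l ≠ [] := by rintro rfl; simpa using h.head
  have ha : l.head hne = a := by
    have := h.head
    rw [List.head?_eq_some_head hne] at this
    simpa using this
  have hb : l.getLast hne = b := by
    have := h.last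
    rw [List.getLast?_eq_some_getLast hne] at this
    simpa using this
  subst ha hb
  have hs : (SimpleGraph.Walk.ofSupport l hne h.chain).support = l := by simp
  exact ⟨_, by rw [SimpleGraph.Walk.isPath_def, hs]; exact h.nodup, hs⟩

theorem exists_cycle (h : IsPathList G a b l) (hadj : G.Adj b a) (hl : 3 ≤ l.length) :
    ∃ p : G.Walk b b, p.IsCycle ∧ p.length = l.length := by
  obtain ⟨p, hp, rfl⟩ := h.exists_walk
  refine ⟨.cons hadj p, ?_, by simp⟩
  rw [SimpleGraph.Walk.cons_isCycle_iff]
  refine ⟨hp, fun he => ?_⟩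
  have h1 : p.length = 1 := by
    have := hp.length_eq_one_of_mem_edges (by simpa [Sym2.eq_swap] using he)
    exact this
  simp [h1] at hl

end IsPathList

theorem List.exists_last_split {α : Type*} (p : α → Prop) (l : List α) (h : ∃ x ∈ l, p x) :
    ∃ l₁ w l₂, l = l₁ ++ w :: l₂ ∧ p w ∧ ∀ x ∈ l₂, ¬ p x := by
  induction l with
  | nil => simp at h
  | cons a l ih =>
    by_cases hl : ∃ x ∈ l, p x
    · obtain ⟨l₁, w, l₂, rfl, hw, h2⟩ := ih hl
      exact ⟨a :: l₁, w, l₂, rfl, hw, h2⟩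
    · push Not at hl
      obtain ⟨x, hx, hpx⟩ := h
      rcases List.mem_cons.1 hx with rfl | hx
      · exact ⟨[], x, l, rfl, hpx, hl⟩
      · exact (hl x hx hpx).elim

theorem List.exists_first_split {α : Type*} (p : α → Prop) (l : List α) (h : ∃ x ∈ l, p x) :
    ∃ l₁ w l₂, l = l₁ ++ w :: l₂ ∧ p w ∧ ∀ x ∈ l₁, ¬ p x := by
  obtain ⟨l₁, w, l₂, h1, hw, h2⟩ := List.exists_last_split p l.reverse (by simpa using h)
  exact ⟨l₂.reverse, w, l₁.reverse, by simpa using congrArg List.reverse h1, hw, by simpa using h2⟩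

/-- The list of `n` consecutive terms `u i, u (i + 1), …` of a cyclic sequence. -/
def cyclicArc {W : Type*} {c : ℕ} (u : ZMod c → W) (i : ZMod c) (n : ℕ) : List W :=
  (List.range n).map fun k : ℕ => u (i + (k : ZMod c))

section cyclicArc

variable {W : Type*} {c : ℕ} {u : ZMod c → W} {i : ZMod c} {n m : ℕ}

@[simp] theorem length_cyclicArc : (cyclicArc u i n).length = n := by simp [cyclicArc]

theorem exists_of_mem_cyclicArc {x : W} (h : x ∈ cyclicArc u i n) : ∃ j, x = u j := by
  obtain ⟨k, -, rfl⟩ := List.mem_map.1 h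
  exact ⟨_, rfl⟩

theorem natCast_injOn_of_lt [NeZero c] {a b : ℕ} (ha : a < c) (hb : b < c)
    (h : (a : ZMod c) = b) : a = b := by
  have := congrArg ZMod.val h
  rwa [ZMod.val_cast_of_lt ha, ZMod.val_cast_of_lt hb] at this

theorem nodup_cyclicArc [NeZero c] (hu : Function.Injective u) (hn : n ≤ c) :
    (cyclicArc u i n).Nodup := by
  refine List.Nodup.map_on ?_ List.nodup_range
  intro a ha b hb h
  rw [List.mem_range] at ha hb
  exact natCast_injOn_of_lt (by omega) (by omega) (add_left_cancel (hu h))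

theorem cyclicArc_append : cyclicArc u i n ++ cyclicArc u (i + n) m = cyclicArc u i (n + m) := by
  simp [cyclicArc, List.range_add, add_assoc]

theorem disjoint_cyclicArc [NeZero c] (hu : Function.Injective u) (hn : n + m ≤ c) :
    (cyclicArc u i n).Disjoint (cyclicArc u (i + n) m) := by
  have := nodup_cyclicArc (i := i) hu hn
  rw [← cyclicArc_append] at this
  exact (List.nodup_append'.1 this).2.2

theorem isPathList_cyclicArc [NeZero c] {G : SimpleGraph W} (hu : Function.Injective u)
    (hadj : 2 ≤ c → ∀ i, G.Adj (u i) (u (i + 1))) (hn : n + 1 ≤ c) :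
    IsPathList G (u i) (u (i + n)) (cyclicArc u i (n + 1)) := by
  refine ⟨?_, nodup_cyclicArc hu hn, ?_, ?_⟩
  · rw [cyclicArc, List.isChain_map, List.isChain_range_succ]
    intro k hk
    have := hadj (by omega) (i + k)
    simpa [add_assoc] using this
  · simp [cyclicArc, List.range_succ_eq_map]
  · simp [cyclicArc, List.range_succ]

end cyclicArc

theorem ZMod.sum_eq_sum_range_add {N : ℕ} [NeZero N] (Y : ZMod N → ℕ) (p : ZMod N) :
    ∑ x, Y x = ∑ k ∈ Finset.range N, Y (p + (k : ZMod N)) := by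
  refine Finset.sum_nbij' (fun x => (x - p).val) (fun k => p + (k : ZMod N)) ?_ ?_ ?_ ?_ ?_
  · intro x _
    simpa using ZMod.val_lt _
  · simp
  · simp
  · intro k hk
    simpa using ZMod.val_cast_of_lt (Finset.mem_range.1 hk)
  · simp

/-- If any two marked points of a cycle of length `N` are at distance at least the average of
their weights, then the total weight is at most `N`. -/
theorem sum_le_of_spaced {N : ℕ} [NeZero N] (Y : ZMod N → ℕ)
    (h : ∀ (p : ZMod N) (r : ℕ), 1 ≤ r → r ≤ N → 0 < Y p → 0 < Y (p + (r : ZMod N)) →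
      Y p + Y (p + (r : ZMod N)) ≤ 2 * r) : ∑ x, Y x ≤ N := by
  by_cases hp : ∃ p, 0 < Y p
  · obtain ⟨p, hp⟩ := hp
    have key : ∀ n ≤ N, ∃ q ≤ n, 0 < Y (p + (q : ZMod N)) ∧
        (∀ k, q < k → k ≤ n → Y (p + (k : ZMod N)) = 0) ∧
        ∑ k ∈ Finset.range (n + 1), 2 * Y (p + (k : ZMod N)) ≤
          Y p + Y (p + (q : ZMod N)) + 2 * q := by
      intro n
      induction n with
      | zero =>
        intro _
        refine ⟨0, le_rfl, by simpa using hp, fun k h1 h2 => by omega, ?_⟩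
        simp; omega
      | succ n ih =>
        intro hn
        obtain ⟨q, hq, hpos, hz, hs⟩ := ih (by omega)
        rw [Finset.sum_range_succ]
        by_cases h0 : Y (p + ((n + 1 : ℕ) : ZMod N)) = 0
        · refine ⟨q, by omega, hpos, fun k h1 h2 => ?_, by omega⟩
          rcases Nat.lt_or_ge n k with h3 | h3
          · obtain rfl : k = n + 1 := by omega
            exact h0
          · exact hz k h1 h3
        · refine ⟨n + 1, le_rfl, by omega, fun k h1 h2 => by omega, ?_⟩
          have e : p + ((n + 1 : ℕ) : ZMod N) = (p + (q : ZMod N)) + ((n + 1 - q : ℕ) : ZMod N) := by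
            rw [add_assoc, ← Nat.cast_add]
            congr 2
            omega
          have := h (p + (q : ZMod N)) (n + 1 - q) (by omega) (by omega) hpos (by rw [← e]; omega)
          rw [← e] at this
          omega
    obtain ⟨q, hq, -, hz, hs⟩ := key N le_rfl
    have hN : p + (N : ZMod N) = p := by simp
    obtain rfl : q = N := by
      by_contra hne
      have := hz N (by omega) le_rfl
      rw [hN] at this
      omega
    rw [Finset.sum_range_succ, hN, ← Finset.mul_sum, ← ZMod.sum_eq_sum_range_add] at hs
    omega
  · push Not at hp
    simp [fun p => Nat.le_zero.1 (hp p)]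

section Weights

variable {c : ℕ} (I : Finset (ZMod c)) (i₀ : ZMod c)

/-- The weight of `e`: one for `e` itself, one more if the successor of `e` is missing from `I`,
and one more if `e` is the distinguished element `i₀`. -/
def cellWeight (e : ZMod c) : ℕ :=
  1 + (if e + 1 ∈ I then 0 else 1) + (if e = i₀ then 1 else 0)

variable {I i₀}

theorem sum_cellWeight [NeZero c] (hI : ∀ i, i ∉ I → i + 1 ∈ I) (h₀ : i₀ ∈ I) :
    ∑ e ∈ I, cellWeight I i₀ e = c + 1 := by
  have h1 : ∑ e ∈ I, (if e + 1 ∈ I then 0 else 1) = (Iᶜ).card := by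
    have : ∑ e ∈ I, (if e + 1 ∈ I then 0 else 1) = (I.filter fun e => e + 1 ∉ I).card := by
      rw [Finset.card_filter]
      exact Finset.sum_congr rfl fun e _ => by split_ifs <;> simp_all
    rw [this]
    refine Finset.card_nbij' (fun e => e + 1) (fun e => e - 1) ?_ ?_ ?_ ?_
    · intro e he; simp_all
    · intro e he
      simp only [Finset.coe_compl, Set.mem_compl_iff, Finset.mem_coe] at he
      have : e - 1 ∈ I := by
        by_contra hc
        exact he (by simpa using hI _ hc)
      simp [this, he]
    · intro e _; simp
    · intro e _; simp
  have h2 : I.card + (Iᶜ).card = c := by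
    rw [Finset.card_add_card_compl, ZMod.card]
  simp only [cellWeight, Finset.sum_add_distrib, h1]
  simp [h₀]

theorem exists_arc_of_notMem [NeZero c] {U : Finset (ZMod c)} {a : ZMod c} (hU : U ⊆ I)
    (hne : U.Nonempty) (ha : a ∈ I) (haU : a ∉ U) :
    ∃ e ∈ U, ∑ e ∈ U, (1 + if e + 1 ∈ I then 0 else 1) ≤ (a - e).val := by
  obtain ⟨e, he, hmax⟩ := Finset.exists_max_image U (fun e => (a - e).val) hne
  refine ⟨e, he, ?_⟩
  have hc : 1 < c := by
    by_contra hc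
    obtain rfl : c = 1 := by have := NeZero.ne c; omega
    obtain ⟨x, hx⟩ := hne
    exact haU (Subsingleton.elim x a ▸ hx)
  have : Fact (1 < c) := ⟨hc⟩
  set S := (U.filter fun e => e + 1 ∉ I).image (· + 1) with hS
  have hdisj : Disjoint U S := by
    rw [Finset.disjoint_left]
    intro x hx hx'
    simp only [hS, Finset.mem_image, Finset.mem_filter] at hx'
    obtain ⟨y, ⟨-, hy⟩, rfl⟩ := hx'
    exact hy (hU hx)
  have hsum : ∑ e ∈ U, (1 + if e + 1 ∈ I then 0 else 1) = (U ∪ S).card := by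
    rw [Finset.card_union_of_disjoint hdisj, Finset.sum_add_distrib,
      Finset.card_image_of_injective _ (add_left_injective 1), Finset.card_filter]
    simp only [Finset.sum_const, smul_eq_mul, mul_one]
    congr 1
    exact Finset.sum_congr rfl fun e _ => by split_ifs <;> simp_all
  rw [hsum]
  have hpos : ∀ x, x ≠ a → 1 ≤ (a - x).val := by
    intro x hx
    rw [Nat.one_le_iff_ne_zero, Ne, ZMod.val_eq_zero, sub_eq_zero]
    exact hx.symm
  calc (U ∪ S).card ≤ (Finset.Icc 1 (a - e).val).card := by
        refine Finset.card_le_card_of_injOn (fun x => (a - x).val) ?_ ?_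
        · intro x hx
          simp only [Finset.coe_union, Set.mem_union, Finset.mem_coe] at hx
          simp only [Finset.coe_Icc, Set.mem_Icc]
          rcases hx with hx | hx
          · exact ⟨hpos x fun h => haU (h ▸ hx), hmax x hx⟩
          · simp only [hS, Finset.mem_image, Finset.mem_filter] at hx
            obtain ⟨y, ⟨hy, hy'⟩, rfl⟩ := hx
            refine ⟨hpos _ fun h => hy' (h ▸ ha), le_trans ?_ (hmax y hy)⟩
            have h1 : 1 ≤ (a - y).val := hpos y fun h => haU (h ▸ hy)
            have : (a - (y + 1)).val = (a - y).val - 1 := by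
              rw [← sub_sub, ZMod.val_sub, ZMod.val_one]
              rwa [ZMod.val_one]
            omega
        · intro x _ y _ hxy
          have := ZMod.val_injective c hxy
          simpa using this
    _ = (a - e).val := by simp

theorem cellWeight_le (h₀ : i₀ + 1 ∈ I) (e : ZMod c) : cellWeight I i₀ e ≤ 2 := by
  unfold cellWeight
  split_ifs with h1 h2 h2 <;> simp_all

theorem cellWeight_self (h₀ : i₀ + 1 ∈ I) : cellWeight I i₀ i₀ = 2 := by
  simp [cellWeight, h₀]

theorem sum_cellWeight_eq (U : Finset (ZMod c)) :
    ∑ e ∈ U, cellWeight I i₀ e =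
      ∑ e ∈ U, (1 + if e + 1 ∈ I then 0 else 1) + if i₀ ∈ U then 1 else 0 := by
  simp only [cellWeight, Finset.sum_add_distrib (f := fun e => 1 + if e + 1 ∈ I then 0 else 1)]
  simp

theorem exists_arc_of_sum_le [NeZero c] (h₀ : i₀ + 1 ∈ I) {U U' : Finset (ZMod c)}
    (hU : U ⊆ I) (hU' : U' ⊆ I) (hne : U.Nonempty) (hne' : U'.Nonempty)
    (hle : ∑ e ∈ U', cellWeight I i₀ e ≤ ∑ e ∈ U, cellWeight I i₀ e) :
    ∃ e ∈ U, ∃ a ∈ U', ∑ e ∈ U, cellWeight I i₀ e + ∑ e ∈ U', cellWeight I i₀ e ≤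
      2 * (a - e).val + 4 := by
  by_cases hsub : U' ⊆ U
  · obtain ⟨a, ha, ha₀⟩ : ∃ a ∈ U', i₀ ∈ U' → a = i₀ := by
      by_cases h : i₀ ∈ U'
      · exact ⟨i₀, h, fun _ => rfl⟩
      · obtain ⟨a, ha⟩ := hne'
        exact ⟨a, ha, fun h' => (h h').elim⟩
    have haU := hsub ha
    have hsplit := Finset.add_sum_erase U (cellWeight I i₀) haU
    have ha2 := cellWeight_le h₀ a
    by_cases hV : (U.erase a).Nonempty
    · obtain ⟨e, he, hsum⟩ := exists_arc_of_notMem (I := I) (U := U.erase a) (a := a)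
        ((Finset.erase_subset _ _).trans hU) hV (hU haU) (by simp)
      refine ⟨e, Finset.mem_of_mem_erase he, a, ha, ?_⟩
      have hw := sum_cellWeight_eq (I := I) (i₀ := i₀) (U.erase a)
      by_cases hi : i₀ ∈ U.erase a
      · have hi' : i₀ ∉ U' := fun h => (Finset.ne_of_mem_erase hi) (ha₀ h).symm
        have h3 : ∑ e ∈ insert i₀ U', cellWeight I i₀ e ≤ ∑ e ∈ U, cellWeight I i₀ e :=
          Finset.sum_le_sum_of_subset (Finset.insert_subset (Finset.mem_of_mem_erase hi) hsub)
        rw [Finset.sum_insert hi', cellWeight_self h₀] at h3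
        rw [if_pos hi] at hw
        omega
      · rw [if_neg hi] at hw
        omega
    · rw [Finset.not_nonempty_iff_eq_empty] at hV
      rw [hV, Finset.sum_empty] at hsplit
      exact ⟨a, haU, a, ha, by omega⟩
  · obtain ⟨a, ha, haU⟩ := Finset.not_subset.1 hsub
    obtain ⟨e, he, hsum⟩ := exists_arc_of_notMem hU hne (hU' ha) haU
    refine ⟨e, he, a, ha, ?_⟩
    have hw := sum_cellWeight_eq (I := I) (i₀ := i₀) U
    split_ifs at hw <;> omega

theorem exists_arc [NeZero c] (h₀ : i₀ + 1 ∈ I) {U U' : Finset (ZMod c)}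
    (hU : U ⊆ I) (hU' : U' ⊆ I) (hne : U.Nonempty) (hne' : U'.Nonempty) :
    ∃ a ∈ U, ∃ b ∈ U',
      ∑ e ∈ U, cellWeight I i₀ e + ∑ e ∈ U', cellWeight I i₀ e ≤
        2 * max (b - a).val (a - b).val + 4 := by
  rcases le_total (∑ e ∈ U', cellWeight I i₀ e) (∑ e ∈ U, cellWeight I i₀ e) with h | h
  · obtain ⟨e, he, a, ha, hs⟩ := exists_arc_of_sum_le h₀ hU hU' hne hne' h
    exact ⟨e, he, a, ha, by omega⟩
  · obtain ⟨e, he, a, ha, hs⟩ := exists_arc_of_sum_le h₀ hU' hU hne' hne h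
    exact ⟨a, ha, e, he, by omega⟩

end Weights

/-- A cyclic sequence `u` together with pairwise disjoint paths leaving it: for every `i`,
`u i :: t i` lists the vertices of a path starting at `u i`. -/
structure IsCycleExtension {W : Type*} (H : SimpleGraph W) {c : ℕ} (u : ZMod c → W)
    (t : ZMod c → List W) : Prop where
  inj : Function.Injective u
  adj : 2 ≤ c → ∀ i, H.Adj (u i) (u (i + 1))
  chain : ∀ i, (u i :: t i).IsChain H.Adj
  nodup : ∀ i, (t i).Nodup
  notMem : ∀ i j, u j ∉ t i
  disj : ∀ i j, i ≠ j → (t i).Disjoint (t j)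

/-- Every cycle of `H` has length at most `c`, in terms of lists of vertices; for `c < 2` the
graph has no edges. -/
def CircumferenceLE {W : Type*} (H : SimpleGraph W) (c : ℕ) : Prop :=
  (∀ a b, H.Adj a b → 2 ≤ c) ∧
    ∀ a b l, IsPathList H a b l → H.Adj b a → 3 ≤ l.length → l.length ≤ c

/-- The last vertex of the path leaving the cyclic sequence `u` at `i`. -/
def extensionTip {W : Type*} {c : ℕ} (u : ZMod c → W) (t : ZMod c → List W) (i : ZMod c) : W :=
  (u i :: t i).getLast (List.cons_ne_nil _ _)

/-- The number of vertices off the cyclic sequence plus the number of nontrivial paths. -/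
def extensionSize {W : Type*} {c : ℕ} [NeZero c] (t : ZMod c → List W) : ℕ :=
  ∑ i, ((t i).length + if (t i).length = 0 then 0 else 1)

namespace IsCycleExtension

variable {W : Type*} {H : SimpleGraph W} {c : ℕ} {u : ZMod c → W} {t : ZMod c → List W}

theorem eq_of_mem (he : IsCycleExtension H u t) {i j : ZMod c} {x : W} (hi : x ∈ t i)
    (hj : x ∈ u j :: t j) : i = j := by
  by_contra hne
  rcases List.mem_cons.1 hj with rfl | hj
  · exact he.notMem _ _ hi
  · exact he.disj i j hne hi hj

theorem nodup_cons (he : IsCycleExtension H u t) (i : ZMod c) : (u i :: t i).Nodup :=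
  List.nodup_cons.2 ⟨he.notMem _ _, he.nodup i⟩

theorem isPathList (he : IsCycleExtension H u t) (i : ZMod c) :
    IsPathList H (u i) (extensionTip u t i) (u i :: t i) :=
  ⟨he.chain i, he.nodup_cons i, by simp, List.getLast?_eq_some_getLast _⟩

theorem reflect (he : IsCycleExtension H u t) :
    IsCycleExtension H (fun i => u (-i)) (fun i => t (-i)) where
  inj := he.inj.comp neg_injective
  adj hc i := by
    have := (he.adj hc (-(i + 1))).symm
    simpa using this
  chain i := he.chain _
  nodup i := he.nodup _
  notMem i j := he.notMem _ _
  disj i j hij := he.disj _ _ (by simpa using hij)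

theorem exists_leg (he : IsCycleExtension H u t) {j : ZMod c} {l₁ l₂ : List W} {w : W}
    (h : u j :: t j = l₁ ++ w :: l₂) :
    ∃ s, IsPathList H (u j) w (u j :: s) ∧ (∀ x ∈ s, x ∈ t j) ∧ u j :: s = l₁ ++ [w] := by
  have hP := he.isPathList j
  rcases l₁ with _ | ⟨y, l₁⟩
  · simp only [List.nil_append, List.cons.injEq] at h
    obtain ⟨rfl, -⟩ := h
    exact ⟨[], .singleton _, by simp, by simp⟩
  · have h' := h
    simp only [List.cons_append, List.cons.injEq] at h
    obtain ⟨rfl, h⟩ := h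
    have e : u j :: t j = (u j :: (l₁ ++ [w])) ++ l₂ := by simp [h]
    refine ⟨l₁ ++ [w], ⟨?_, ?_, by simp, by simp [List.getLast?_cons]⟩, ?_, by simp⟩
    · exact (e ▸ hP.chain).left_of_append
    · exact (List.nodup_append'.1 (e ▸ hP.nodup)).1
    · intro x hx
      rw [h]
      simp only [List.mem_append, List.mem_cons, List.not_mem_nil, or_false] at hx ⊢
      tauto

/-- Two vertices of the cycle with a common neighbour off the cycle cannot have adjacent
extended successors. -/
theorem not_adj_succ [NeZero c] (he : IsCycleExtension H u t) (hb : CircumferenceLE H c)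
    {i j : ZMod c} {x w : W} (hij : i ≠ j) (hx : ∀ k, u k ≠ x) (hi : H.Adj (u i) x)
    (hj : H.Adj (u j) x) (hw : w ∈ u (j + 1) :: t (j + 1)) (hxt : x ∉ t (j + 1)) :
    ¬ H.Adj (u (i + 1)) w := by
  intro hadj
  obtain ⟨n, hn⟩ : ∃ n, (j - i).val = n + 1 := by
    refine Nat.exists_eq_succ_of_ne_zero ?_
    rw [Ne, ZMod.val_eq_zero, sub_eq_zero]
    exact hij.symm
  obtain ⟨m, hm⟩ : ∃ m, c = (n + 1) + (m + 1) := by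
    have := ZMod.val_lt (j - i)
    exact ⟨c - (n + 2), by omega⟩
  have e1 : i + 1 + (n : ZMod c) = j := by
    have : ((n + 1 : ℕ) : ZMod c) = j - i := by rw [← hn]; simp
    push_cast at this
    linear_combination this
  have e2 : i + 1 + ((n + 1 : ℕ) : ZMod c) = j + 1 := by push_cast; linear_combination e1
  have e3 : j + 1 + (m : ZMod c) = i := by
    have : (((n + 1) + (m + 1) : ℕ) : ZMod c) = 0 := by rw [← hm]; simp
    push_cast at this
    linear_combination this - e1
  have hP1 := isPathList_cyclicArc (i := i + 1) (n := n) he.inj he.adj (by omega)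
  have hP2 := isPathList_cyclicArc (i := j + 1) (n := m) he.inj he.adj (by omega)
  rw [e1] at hP1
  rw [e3] at hP2
  have hd := disjoint_cyclicArc (i := i + 1) (n := n + 1) (m := m + 1) he.inj hm.ge
  rw [e2] at hd
  obtain ⟨l₁, l₂, hl⟩ := List.append_of_mem hw
  obtain ⟨s, hs, hst, -⟩ := he.exists_leg hl
  have hsu : ∀ k, u k ∉ s := fun k hk => he.notMem _ _ (hst _ hk)
  have hQ1 : IsPathList H (u (i + 1)) x (cyclicArc u (i + 1) (n + 1) ++ [x]) := by
    refine hP1.append (.singleton x) hj ?_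
    intro y hy hy'
    obtain ⟨k, rfl⟩ := exists_of_mem_cyclicArc hy
    exact hx k (by simpa using hy')
  have hQ2 : IsPathList H (u i) w ((cyclicArc u (j + 1) (m + 1)).reverse ++ s) := by
    refine hP2.reverse.glue hs ?_
    intro y hy hy'
    obtain ⟨k, rfl⟩ := exists_of_mem_cyclicArc (List.mem_reverse.1 hy)
    exact hsu k hy'
  have hQ := hQ1.append hQ2 hi.symm (by
    intro y hy hy'
    simp only [List.mem_append, List.mem_reverse, List.mem_singleton] at hy hy'
    rcases hy with hy | rfl <;> rcases hy' with hy' | hy'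
    · exact hd hy hy'
    · obtain ⟨k, rfl⟩ := exists_of_mem_cyclicArc hy
      exact hsu k hy'
    · obtain ⟨k, rfl⟩ := exists_of_mem_cyclicArc hy'
      exact hx k rfl
    · exact hxt (hst _ hy'))
  have := hb.2 _ _ _ hQ hadj.symm (by simp; omega)
  simp at this
  omega

theorem not_adj_adj_succ [NeZero c] (he : IsCycleExtension H u t) (hb : CircumferenceLE H c)
    {i : ZMod c} {x : W} (hx : ∀ k, u k ≠ x) (hi : H.Adj (u i) x) : ¬ H.Adj (u (i + 1)) x := by
  intro hj
  have hc := hb.1 _ _ hi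
  obtain ⟨n, rfl⟩ : ∃ n, c = n + 1 := ⟨c - 1, by omega⟩
  have hP := isPathList_cyclicArc (i := i + 1) (n := n) he.inj he.adj (by omega)
  have e : i + 1 + (n : ZMod (n + 1)) = i := by
    have : ((n + 1 : ℕ) : ZMod (n + 1)) = 0 := by simp
    push_cast at this
    linear_combination this
  rw [e] at hP
  have hQ := hP.append (.singleton x) hi (by
    intro y hy hy'
    obtain ⟨k, rfl⟩ := exists_of_mem_cyclicArc hy
    exact hx k (by simpa using hy'))
  have := hb.2 _ _ _ hQ hj.symm (by simp; omega)
  simp at this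

theorem exists_path_tip [NeZero c] (he : IsCycleExtension H u t) {i j : ZMod c} (hij : i ≠ j) :
    ∃ l, IsPathList H (extensionTip u t i) (extensionTip u t j) l ∧
      (j - i).val + 1 ≤ l.length := by
  have hlt := ZMod.val_lt (j - i)
  have hP := isPathList_cyclicArc (i := i) (n := (j - i).val) he.inj he.adj (by omega)
  have e : i + ((j - i).val : ZMod c) = j := by simp
  rw [e] at hP
  have h1 := hP.glue (he.isPathList j) (by
    intro y hy hy'
    obtain ⟨k, rfl⟩ := exists_of_mem_cyclicArc hy
    exact he.notMem _ _ hy')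
  have h2 := h1.reverse.glue (he.isPathList i) (by
    intro y hy hy'
    rw [List.mem_reverse, List.mem_append] at hy
    rcases hy with hy | hy
    · obtain ⟨k, rfl⟩ := exists_of_mem_cyclicArc hy
      exact he.notMem _ _ hy'
    · exact he.disj _ _ hij hy' hy)
  refine ⟨_, h2.reverse, ?_⟩
  simp
  omega

theorem update_tail [DecidableEq (ZMod c)] (he : IsCycleExtension H u t) {i : ZMod c} {l : List W}
    (hchain : (u i :: l).IsChain H.Adj) (hnodup : l.Nodup) (hnot : ∀ j, u j ∉ l)
    (hdisj : ∀ j, j ≠ i → l.Disjoint (t j)) : IsCycleExtension H u (Function.update t i l) where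
  inj := he.inj
  adj := he.adj
  chain j := by
    rcases eq_or_ne j i with rfl | h
    · simpa using hchain
    · simpa [h] using he.chain j
  nodup j := by
    rcases eq_or_ne j i with rfl | h
    · simpa using hnodup
    · simpa [h] using he.nodup j
  notMem j k := by
    rcases eq_or_ne j i with rfl | h
    · simpa using hnot k
    · simpa [h] using he.notMem j k
  disj j k hjk := by
    rcases eq_or_ne j i with rfl | h
    · simpa [hjk.symm] using hdisj k hjk.symm
    · rcases eq_or_ne k i with rfl | h'
      · simpa [h] using (hdisj j h).symm
      · simpa [h, h'] using he.disj j k hjk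

end IsCycleExtension

/-- An extension of a cyclic sequence of largest possible size. -/
structure IsMaximalExtension {W : Type*} (H : SimpleGraph W) {c : ℕ} [NeZero c] (u : ZMod c → W)
    (t : ZMod c → List W) : Prop extends IsCycleExtension H u t where
  le_size : ∀ t', IsCycleExtension H u t' → extensionSize t' ≤ extensionSize t

theorem IsCycleExtension.exists_maximal {W : Type*} [Fintype W] {H : SimpleGraph W} {c : ℕ}
    [NeZero c] {u : ZMod c → W} {t : ZMod c → List W} (he : IsCycleExtension H u t) :
    ∃ t', IsMaximalExtension H u t' := by
  let S : Set ℕ := {n | ∃ t', IsCycleExtension H u t' ∧ extensionSize t' = n}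
  have hbdd : BddAbove S := by
    refine ⟨∑ _i : ZMod c, (Fintype.card W + 1), ?_⟩
    rintro n ⟨t', ht', rfl⟩
    refine Finset.sum_le_sum fun i _ => ?_
    have := (ht'.nodup i).length_le_card
    split_ifs <;> omega
  have hmem : sSup S ∈ S := Nat.sSup_mem ⟨_, t, he, rfl⟩ hbdd
  obtain ⟨t', ht', hs⟩ := hmem
  refine ⟨t', ht', fun t'' ht'' => ?_⟩
  rw [hs]
  exact le_csSup hbdd ⟨t'', ht'', rfl⟩

section

variable {W : Type*} {H : SimpleGraph W} {c : ℕ} {u : ZMod c → W} {t : ZMod c → List W}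

theorem extensionTip_mem {i : ZMod c} (hi : t i ≠ []) :
    extensionTip u t i ∈ t i := by
  rw [extensionTip, List.getLast_cons hi]
  exact List.getLast_mem hi

theorem extensionTip_of_eq_nil {i : ZMod c} (hi : t i = []) : extensionTip u t i = u i := by
  simp [extensionTip, hi]

variable [Fintype W]

open scoped Classical in
/-- The number of neighbours of `x` on the `j`-th path, including its first vertex. -/
noncomputable def nbrCount (H : SimpleGraph W) (u : ZMod c → W) (t : ZMod c → List W) (x : W)
    (j : ZMod c) : ℕ :=
  (Finset.univ.filter fun y => y ∈ u j :: t j ∧ H.Adj x y).card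

theorem nbrCount_pos {x : W} {j : ZMod c} :
    0 < nbrCount H u t x j ↔ ∃ y ∈ u j :: t j, H.Adj x y := by
  classical
  rw [nbrCount, Finset.card_pos]
  simp [Finset.Nonempty]

theorem nbrCount_le_length {x : W} {j : ZMod c} {l : List W}
    (h : ∀ y ∈ u j :: t j, H.Adj x y → y ∈ l) : nbrCount H u t x j ≤ l.length := by
  classical
  refine le_trans (Finset.card_le_card (t := l.toFinset) ?_) l.toFinset_card_le
  intro y hy
  rw [Finset.mem_filter] at hy
  exact List.mem_toFinset.2 (h y hy.2.1 hy.2.2)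

end

namespace IsMaximalExtension

variable {W : Type*} {H : SimpleGraph W} {c : ℕ} [NeZero c] {u : ZMod c → W} {t : ZMod c → List W}

theorem exists_mem_of_adj_tip (he : IsMaximalExtension H u t) {i : ZMod c} {y : W}
    (hy : H.Adj (extensionTip u t i) y) : ∃ j, y ∈ u j :: t j := by
  by_contra! hc
  have hne : ∀ j, u j ≠ y ∧ y ∉ t j := fun j => by
    have := hc j
    simp only [List.mem_cons, not_or] at this
    exact ⟨Ne.symm this.1, this.2⟩
  have hP := (he.isPathList i).append (.singleton y) hy (by
    intro x hx hx'
    rw [List.mem_singleton] at hx'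
    exact hc i (hx' ▸ hx))
  have h := he.update_tail (i := i) (l := t i ++ [y]) hP.chain hP.nodup.of_cons
    (fun j hj => by
      rcases List.mem_append.1 hj with hj | hj
      · exact he.notMem _ _ hj
      · exact (hne j).1 (List.mem_singleton.1 hj))
    (fun j hji x hx hx' => by
      rcases List.mem_append.1 hx with hx | hx
      · exact he.disj _ _ hji.symm hx hx'
      · exact (hne j).2 (List.mem_singleton.1 hx ▸ hx'))
  have hlt : extensionSize t < extensionSize (Function.update t i (t i ++ [y])) := by
    refine Finset.sum_lt_sum (fun j _ => ?_) ⟨i, Finset.mem_univ _, ?_⟩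
    · rcases eq_or_ne j i with rfl | hj
      · simp; split_ifs <;> omega
      · simp [hj]
    · simp; split_ifs <;> omega
  exact absurd (he.le_size _ h) (by omega)

theorem head?_of_adj (he : IsMaximalExtension H u t) {i j : ZMod c} {w : W} (hi : t i = [])
    (hw : w ∈ t j) (hadj : H.Adj (u i) w) : (t j).head? = some w := by
  obtain ⟨l₁, l₂, hl⟩ := List.append_of_mem hw
  rcases l₁ with _ | ⟨y, l₁⟩
  · simp [hl]
  exfalso
  have hij : i ≠ j := by rintro rfl; simp [hi] at hw
  have hchain := he.chain j
  have hnodup := he.nodup j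
  rw [hl] at hnodup
  have e : u j :: t j = (u j :: y :: l₁) ++ w :: l₂ := by simp [hl]
  rw [e, List.isChain_append] at hchain
  rw [List.nodup_append'] at hnodup
  have hs₁ : ∀ x ∈ y :: l₁, x ∈ t j := fun x hx => by rw [hl]; exact List.mem_append_left _ hx
  have hs₂ : ∀ x ∈ w :: l₂, x ∈ t j := fun x hx => by rw [hl]; exact List.mem_append_right _ hx
  have h₁ := he.update_tail (i := j) (l := y :: l₁) hchain.1 hnodup.1
    (fun k hk => he.notMem _ _ (hs₁ _ hk))
    (fun k hk x hx hx' => he.disj _ _ hk.symm (hs₁ _ hx) hx')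
  have h₂ := h₁.update_tail (i := i) (l := w :: l₂)
    (List.isChain_cons_cons.2 ⟨hadj, hchain.2.1⟩) hnodup.2.1
    (fun k hk => he.notMem _ _ (hs₂ _ hk))
    (fun k hk x hx hx' => by
      rcases eq_or_ne k j with rfl | hkj
      · rw [Function.update_self] at hx'
        exact hnodup.2.2 hx' hx
      · rw [Function.update_of_ne hkj] at hx'
        exact he.disj _ _ hkj.symm (hs₂ _ hx) hx')
  have hlt : extensionSize t <
      extensionSize (Function.update (Function.update t j (y :: l₁)) i (w :: l₂)) := by
    unfold extensionSize
    have hj : j ∈ (Finset.univ : Finset (ZMod c)).erase i := by simp [hij.symm]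
    rw [← Finset.add_sum_erase _ _ (Finset.mem_univ i), ← Finset.add_sum_erase _ _ hj,
      ← Finset.add_sum_erase (a := i) (Finset.univ) _ (Finset.mem_univ i),
      ← Finset.add_sum_erase _ _ hj]
    have hrest : ∑ k ∈ (Finset.univ.erase i).erase j,
        ((Function.update (Function.update t j (y :: l₁)) i (w :: l₂) k).length +
          if (Function.update (Function.update t j (y :: l₁)) i (w :: l₂) k).length = 0
            then 0 else 1) =
        ∑ k ∈ (Finset.univ.erase i).erase j, ((t k).length +
          if (t k).length = 0 then 0 else 1) := by
      refine Finset.sum_congr rfl fun k hk => ?_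
      simp only [Finset.mem_erase, Finset.mem_univ, and_true] at hk
      simp [hk.1, hk.2]
    rw [hrest]
    simp [hij.symm, hi, hl]
    omega
  exact absurd (he.le_size _ h₂) (by omega)

variable [Fintype W]

open scoped Classical in
theorem card_nbrs_le_sum (he : IsMaximalExtension H u t) (i : ZMod c) :
    (Finset.univ.filter fun y => H.Adj (extensionTip u t i) y).card ≤
      ∑ j, nbrCount H u t (extensionTip u t i) j := by
  refine le_trans (Finset.card_le_card ?_) Finset.card_biUnion_le
  intro y hy
  rw [Finset.mem_filter] at hy
  obtain ⟨j, hj⟩ := he.exists_mem_of_adj_tip hy.2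
  rw [Finset.mem_biUnion]
  exact ⟨j, Finset.mem_univ _, by simpa using ⟨by simpa using hj, hy.2⟩⟩

/-- The neighbours of a nontrivial tip on two different paths force a long arc between them. -/
theorem nbrCount_add_le (he : IsMaximalExtension H u t) (hb : CircumferenceLE H c) {i p k : ZMod c}
    (hi : t i ≠ []) (hpk : p ≠ k) (hp : 0 < nbrCount H u t (extensionTip u t i) p)
    (hk : 0 < nbrCount H u t (extensionTip u t i) k) :
    nbrCount H u t (extensionTip u t i) p + nbrCount H u t (extensionTip u t i) k ≤
      (k - p).val := by
  set v := extensionTip u t i with hv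
  have hvt : v ∈ t i := extensionTip_mem (u := u) hi
  have leg : ∀ j, 0 < nbrCount H u t v j → ∃ w s, IsPathList H (u j) w (u j :: s) ∧
      (∀ x ∈ s, x ∈ t j) ∧ H.Adj v w ∧ v ∉ u j :: s ∧ nbrCount H u t v j ≤ s.length + 1 := by
    intro j hj
    obtain ⟨l₁, w, l₂, hl, hw, hnot⟩ :=
      List.exists_last_split (fun y => H.Adj v y) _ (nbrCount_pos.1 hj)
    obtain ⟨s, hs, hst, hsl⟩ := he.exists_leg hl
    refine ⟨w, s, hs, hst, hw, ?_, ?_⟩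
    · intro hvs
      have hvw : v ≠ w := hw.ne
      rw [hsl] at hvs
      have hv1 : v ∈ l₁ := by
        simp only [List.mem_append, List.mem_singleton] at hvs
        exact hvs.resolve_right hvw
      have hij : i = j := he.eq_of_mem hvt (by rw [hl]; exact List.mem_append_left _ hv1)
      subst hij
      have hlast := (he.isPathList i).last
      have hnd := he.nodup_cons i
      rw [hl] at hlast hnd
      have hv2 : v ∈ w :: l₂ := by
        refine List.mem_of_getLast? ?_
        simpa [← hv] using hlast
      exact (List.nodup_append'.1 hnd).2.2 hv1 hv2
    · have := nbrCount_le_length (H := H) (u := u) (t := t) (x := v) (j := j) (l := l₁ ++ [w]) (by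
        intro y hy hay
        rw [hl] at hy
        simp only [List.mem_append, List.mem_cons, List.not_mem_nil, or_false] at hy ⊢
        rcases hy with hy | hy | hy
        · exact Or.inl hy
        · exact Or.inr hy
        · exact (hnot y hy hay).elim)
      rw [← hsl] at this
      simpa using this
  obtain ⟨w, s, hs, hst, hw, hvs, hns⟩ := leg p hp
  obtain ⟨w', s', hs', hst', hw', hvs', hns'⟩ := leg k hk
  have hlt := ZMod.val_lt (k - p)
  obtain ⟨n, hn⟩ : ∃ n, c = (k - p).val + n := ⟨c - (k - p).val, by omega⟩
  have hr : 0 < (k - p).val := by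
    rw [Nat.pos_iff_ne_zero, Ne, ZMod.val_eq_zero, sub_eq_zero]
    exact hpk.symm
  have e : k + (n : ZMod c) = p := by
    have h1 : (((k - p).val + n : ℕ) : ZMod c) = 0 := by rw [← hn]; simp
    push_cast at h1
    rw [ZMod.natCast_zmod_val] at h1
    linear_combination h1
  have hP := isPathList_cyclicArc (i := k) (n := n) he.inj he.adj (by omega)
  rw [e] at hP
  have hvu : ∀ j, u j ≠ v := fun j h => he.notMem i j (h ▸ hvt)
  have h1 := hP.glue hs (by
    intro y hy hy'
    obtain ⟨j, rfl⟩ := exists_of_mem_cyclicArc hy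
    exact he.notMem _ _ (hst _ hy'))
  have h2 := h1.reverse.glue hs' (by
    intro y hy hy'
    rw [List.mem_reverse, List.mem_append] at hy
    rcases hy with hy | hy
    · obtain ⟨j, rfl⟩ := exists_of_mem_cyclicArc hy
      exact he.notMem _ _ (hst' _ hy')
    · exact he.disj _ _ hpk (hst _ hy) (hst' _ hy'))
  have h3 := h2.append (.singleton v) hw'.symm (by
    intro y hy hy'
    rw [List.mem_singleton] at hy'
    subst hy'
    rw [List.mem_append, List.mem_reverse, List.mem_append] at hy
    rcases hy with (hy | hy) | hy
    · obtain ⟨j, hj⟩ := exists_of_mem_cyclicArc hy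
      exact hvu j hj.symm
    · exact hvs (List.mem_cons_of_mem _ hy)
    · exact hvs' (List.mem_cons_of_mem _ hy))
  have := hb.2 _ _ _ h3 hw (by simp; omega)
  simp at this
  omega

open scoped Classical in
theorem card_nbrs_lt_of_ne_nil (he : IsMaximalExtension H u t) (hb : CircumferenceLE H c)
    {i : ZMod c} (hi : t i ≠ []) :
    (Finset.univ.filter fun y => H.Adj (extensionTip u t i) y).card < c := by
  have hspace := fun p k => he.nbrCount_add_le (p := p) (k := k) hb hi
  have htotal := he.card_nbrs_le_sum i
  have hvt := extensionTip_mem (u := u) hi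
  obtain ⟨v, hv⟩ : ∃ v, v = extensionTip u t i := ⟨_, rfl⟩
  simp only [← hv] at hspace htotal hvt ⊢
  have hpred : 0 < nbrCount H u t v i := by
    rw [nbrCount_pos]
    obtain ⟨l, hl⟩ : ∃ l, u i :: t i = (u i :: l) ++ [v] := by
      refine ⟨(t i).dropLast, ?_⟩
      have : v = (t i).getLast hi := by rw [hv, extensionTip, List.getLast_cons hi]
      rw [this, List.cons_append, List.dropLast_append_getLast]
    have hch := he.chain i
    rw [hl, List.isChain_append] at hch
    refine ⟨(u i :: l).getLast (by simp), ?_, ?_⟩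
    · rw [hl]
      exact List.mem_append_left _ (List.getLast_mem _)
    · exact (hch.2.2 _ (List.getLast?_eq_some_getLast _) v (by simp)).symm
  obtain ⟨y₀, -, hy₀⟩ := nbrCount_pos.1 hpred
  have hc := hb.1 _ _ hy₀
  by_cases hout : ∃ j, j ≠ i ∧ 0 < nbrCount H u t v j
  · have hsum : ∑ j, 2 * nbrCount H u t v j ≤ c := by
      refine sum_le_of_spaced _ fun p r hr hrc hp hk => ?_
      have hp' : 0 < nbrCount H u t v p := by omega
      have hk' : 0 < nbrCount H u t v (p + r) := by omega
      rcases Nat.lt_or_ge r c with hlt | hge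
      · have hne : p ≠ p + (r : ZMod c) := by
          intro h
          have : (r : ZMod c) = ((0 : ℕ) : ZMod c) := by
            rw [Nat.cast_zero]
            exact (left_eq_add.1 h)
          have := natCast_injOn_of_lt hlt (by omega) this
          omega
        have := hspace _ _ hne hp' hk'
        rw [add_sub_cancel_left, ZMod.val_cast_of_lt hlt] at this
        omega
      · obtain rfl : r = c := le_antisymm hrc hge
        obtain ⟨k, hkp, hk⟩ : ∃ k, k ≠ p ∧ 0 < nbrCount H u t v k := by
          by_cases hpi : p = i
          · rw [hpi]; exact hout
          · exact ⟨i, Ne.symm hpi, hpred⟩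
        have h1 := hspace _ _ hkp.symm hp' hk
        have h2 := hspace _ _ hkp hk hp'
        have h3 : (p - k).val + (k - p).val = r := by
          have hne : NeZero (k - p) := ⟨sub_ne_zero.2 hkp⟩
          have := ZMod.val_neg_of_ne_zero (k - p)
          rw [neg_sub] at this
          have := ZMod.val_lt (k - p)
          omega
        simp only [CharP.cast_eq_zero, add_zero]
        omega
    rw [← Finset.mul_sum] at hsum
    omega
  · push Not at hout
    obtain ⟨l₁, w, l₂, hl, hw, hnot⟩ :=
      List.exists_first_split (fun y => H.Adj v y) _ (nbrCount_pos.1 hpred)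
    have hP := he.isPathList i
    have hch := hP.chain
    have hnd := hP.nodup
    have hlast := hP.last
    rw [hl] at hch hnd hlast
    have hQ : IsPathList H w v (w :: l₂) :=
      ⟨(List.isChain_append.1 hch).2.1, (List.nodup_append'.1 hnd).2.1, by simp,
        by simpa [← hv] using hlast⟩
    have hcard : (Finset.univ.filter fun y => H.Adj v y).card + 1 ≤ (w :: l₂).length := by
      rw [← Finset.card_insert_of_notMem (a := v) (by simp),
        ← List.toFinset_card_of_nodup hQ.nodup]
      refine Finset.card_le_card fun y hy => ?_
      rw [List.mem_toFinset]
      rcases Finset.mem_insert.1 hy with rfl | hy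
      · exact hQ.last_mem
      · have hay : H.Adj v y := (Finset.mem_filter.1 hy).2
        obtain ⟨j, hj⟩ := he.exists_mem_of_adj_tip (i := i) (hv ▸ hay)
        have hji : j = i := by
          by_contra hji
          have := hout j hji
          have := nbrCount_pos.2 ⟨y, hj, hay⟩
          omega
        rw [hji, hl] at hj
        rcases List.mem_append.1 hj with hj | hj
        · exact (hnot y hj hay).elim
        · exact hj
    by_cases h3 : 3 ≤ (w :: l₂).length
    · have := hb.2 _ _ _ hQ hw h3
      omega
    · omega

end IsMaximalExtension

section headNbrs

variable {W : Type*} {c : ℕ} [NeZero c]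

open scoped Classical in
/-- The indices of the nontrivial paths whose first vertex off the cycle is adjacent to `u i`. -/
noncomputable def headNbrs (H : SimpleGraph W) (u : ZMod c → W) (t : ZMod c → List W)
    (i : ZMod c) : Finset (ZMod c) :=
  Finset.univ.filter fun j => ∃ x, (t j).head? = some x ∧ H.Adj (u i) x

open scoped Classical in
/-- The indices `j ≠ i` of the paths without neighbours of `u i`. -/
noncomputable def missedPaths (H : SimpleGraph W) (u : ZMod c → W) (t : ZMod c → List W)
    (i : ZMod c) : Finset (ZMod c) :=
  Finset.univ.filter fun j => j ≠ i ∧ ∀ w ∈ u j :: t j, ¬ H.Adj (u i) w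

variable {H : SimpleGraph W} {u : ZMod c → W} {t : ZMod c → List W} {i j : ZMod c}

theorem mem_headNbrs : j ∈ headNbrs H u t i ↔ ∃ x, (t j).head? = some x ∧ H.Adj (u i) x := by
  simp [headNbrs]

theorem mem_missedPaths :
    j ∈ missedPaths H u t i ↔ j ≠ i ∧ ∀ w ∈ u j :: t j, ¬ H.Adj (u i) w := by
  simp [missedPaths]

theorem IsCycleExtension.exists_of_mem_headNbrs (he : IsCycleExtension H u t)
    (h : j ∈ headNbrs H u t i) :
    ∃ x ∈ t j, H.Adj (u i) x ∧ H.Adj (u j) x ∧ ∀ k, u k ≠ x := by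
  obtain ⟨x, hx, hadj⟩ := mem_headNbrs.1 h
  have hxt := List.mem_of_head? hx
  refine ⟨x, hxt, hadj, ?_, fun k hk => he.notMem j k (hk ▸ hxt)⟩
  have := he.chain j
  rcases h : t j with _ | ⟨y, l⟩
  · simp [h] at hx
  · rw [h] at hx this
    simp only [List.head?_cons, Option.some.injEq] at hx
    subst hx
    exact (List.isChain_cons_cons.1 this).1

theorem IsCycleExtension.card_headNbrs_le (he : IsCycleExtension H u t)
    (hb : CircumferenceLE H c) (hi : t i = []) :
    (headNbrs H u t i).card ≤ (missedPaths H u t (i + 1)).card := by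
  refine Finset.card_le_card_of_injOn (· + 1) (fun j hj => ?_) (add_left_injective 1).injOn
  obtain ⟨x, hxt, hix, hjx, hx⟩ := he.exists_of_mem_headNbrs hj
  have hij : i ≠ j := by
    rintro rfl
    simp [hi] at hxt
  refine mem_missedPaths.2 ⟨by simpa using hij.symm, fun w hw => ?_⟩
  refine he.not_adj_succ hb hij hx hix hjx hw fun hxt' => ?_
  have h1 : (1 : ZMod c) = 0 := left_eq_add.1 (he.eq_of_mem hxt (List.mem_cons_of_mem _ hxt'))
  exact hij (by linear_combination (i - j) * h1)

theorem card_headNbrs_reflect :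
    (headNbrs H (fun k => u (-k)) (fun k => t (-k)) (-i)).card = (headNbrs H u t i).card := by
  refine Finset.card_bij' (fun j _ => -j) (fun j _ => -j) ?_ ?_ ?_ ?_ <;> simp [mem_headNbrs]

theorem card_missedPaths_reflect :
    (missedPaths H (fun k => u (-k)) (fun k => t (-k)) (-i)).card =
      (missedPaths H u t i).card := by
  refine Finset.card_bij' (fun j _ => -j) (fun j _ => -j) ?_ ?_ ?_ ?_ <;>
    simp [mem_missedPaths, neg_eq_iff_eq_neg]

theorem IsCycleExtension.card_headNbrs_succ_le (he : IsCycleExtension H u t)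
    (hb : CircumferenceLE H c) (hi : t (i + 1) = []) :
    (headNbrs H u t (i + 1)).card ≤ (missedPaths H u t i).card := by
  have := he.reflect.card_headNbrs_le hb (i := -(i + 1)) (by simpa using hi)
  rw [card_headNbrs_reflect, show -(i + 1) + 1 = -i by ring, card_missedPaths_reflect] at this
  exact this

/-- The trivial ends cannot alternate with the others and see more heads than they miss paths. -/
theorem IsCycleExtension.exists_card_headNbrs_le (he : IsCycleExtension H u t)
    (hb : CircumferenceLE H c) {B : Finset (ZMod c)} (hB : B.Nonempty)
    (ht : ∀ i ∈ B, t i = []) (h₁ : ∀ i, i ∉ B → i + 1 ∈ B) :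
    ∃ i ∈ B, (headNbrs H u t i).card ≤ (missedPaths H u t i).card := by
  by_contra! hlt
  have hsum := Finset.sum_lt_sum_of_nonempty hB hlt
  rw [← Finset.card_sigma, ← Finset.card_sigma] at hsum
  refine absurd hsum (not_lt.2 ?_)
  refine Finset.card_le_card_of_injOn (fun p => ⟨p.2 + 1, p.1 + 1⟩) ?_ ?_
  · rintro ⟨i, j⟩ hp
    simp only [Finset.coe_sigma, Set.mem_sigma_iff, Finset.mem_coe] at hp ⊢
    obtain ⟨hi, hj⟩ := hp
    obtain ⟨x, hxt, hix, hjx, hx⟩ := he.exists_of_mem_headNbrs hj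
    have hjB : j ∉ B := fun h => by simp [ht j h] at hxt
    have hij : i ≠ j := by rintro rfl; exact hjB hi
    refine ⟨h₁ j hjB, mem_missedPaths.2 ⟨by simpa using hij, fun w hw => ?_⟩⟩
    refine he.not_adj_succ hb hij.symm hx hjx hix hw fun hxt' => ?_
    have := he.eq_of_mem hxt (List.mem_cons_of_mem _ hxt')
    subst this
    exact he.not_adj_adj_succ hb hx hix hjx
  · rintro ⟨i, j⟩ - ⟨i', j'⟩ - h
    simp only [Sigma.mk.injEq, add_left_inj, heq_eq_eq] at h
    simp [h]

end headNbrs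

namespace IsMaximalExtension

variable {W : Type*} [Fintype W] {H : SimpleGraph W} {c : ℕ} [NeZero c] {u : ZMod c → W}
  {t : ZMod c → List W}

open scoped Classical in
theorem card_nbrs_add_card_missedPaths_lt (he : IsMaximalExtension H u t) {i : ZMod c}
    (hi : t i = []) :
    (Finset.univ.filter fun y => H.Adj (extensionTip u t i) y).card +
      (missedPaths H u t i).card < c + (headNbrs H u t i).card := by
  have hsub : missedPaths H u t i ⊆ Finset.univ.erase i := fun j hj => by
    simpa using (mem_missedPaths.1 hj).1
  have h1 := Finset.card_sdiff_add_card_eq_card hsub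
  rw [Finset.card_erase_of_mem (Finset.mem_univ _), Finset.card_univ, ZMod.card] at h1
  have h2 : (Finset.univ.filter fun y => H.Adj (extensionTip u t i) y) ⊆
      (Finset.univ.erase i \ missedPaths H u t i).image u ∪
        (headNbrs H u t i).image fun j => (t j).headD (u j) := by
    intro y hy
    have hy := (Finset.mem_filter.1 hy).2
    obtain ⟨j, hj⟩ := he.exists_mem_of_adj_tip hy
    rw [extensionTip_of_eq_nil hi] at hy
    rw [Finset.mem_union, Finset.mem_image, Finset.mem_image]
    rcases List.mem_cons.1 hj with rfl | hj
    · refine Or.inl ⟨j, ?_, rfl⟩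
      rw [Finset.mem_sdiff, mem_missedPaths]
      refine ⟨by simpa using fun h : j = i => hy.ne (h ▸ rfl), fun h => ?_⟩
      exact h.2 _ List.mem_cons_self hy
    · have := he.head?_of_adj hi hj hy
      exact Or.inr ⟨j, mem_headNbrs.2 ⟨y, this, hy⟩, by rw [List.headD_eq_head?_getD, this]; rfl⟩
  have h3 := (Finset.card_le_card h2).trans (Finset.card_union_le _ _)
  have h4 := Finset.card_image_le (s := Finset.univ.erase i \ missedPaths H u t i) (f := u)
  have h5 := Finset.card_image_le (s := headNbrs H u t i) (f := fun j => (t j).headD (u j))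
  have := NeZero.pos c
  omega

end IsMaximalExtension

open scoped Classical in
/-- A longest cycle of `H` yields a weighted family of vertices of small degree, of total weight
one more than the length of the cycle, joined by paths that are long compared to the weights. -/
theorem exists_weighted_tips {W : Type*} [Fintype W] {H : SimpleGraph W} {c : ℕ} [NeZero c]
    {u : ZMod c → W} (hu : Function.Injective u) (hadj : 2 ≤ c → ∀ i, H.Adj (u i) (u (i + 1)))
    (hb : CircumferenceLE H c) :
    ∃ (I : Finset (ZMod c)) (v : ZMod c → W) (y : ZMod c → ℕ), ∑ i ∈ I, y i = c + 1 ∧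
      (∀ i ∈ I, (Finset.univ.filter fun x => H.Adj (v i) x).card < c) ∧
      ∀ U ⊆ I, ∀ U' ⊆ I, U.Nonempty → U'.Nonempty → ∃ a ∈ U, ∃ b ∈ U', ∃ l,
        IsPathList H (v a) (v b) l ∧ ∑ i ∈ U, y i + ∑ i ∈ U', y i ≤ 2 * (l.length + 1) := by
  have he₀ : IsCycleExtension H u fun _ => [] :=
    ⟨hu, hadj, fun _ => by simp, fun _ => by simp, fun _ _ => by simp, fun _ _ _ => by simp⟩
  obtain ⟨t, he⟩ := he₀.exists_maximal
  set I : Finset (ZMod c) := Finset.univ.filter fun i =>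
    (Finset.univ.filter fun x => H.Adj (extensionTip u t i) x).card < c with hIdef
  have hmem : ∀ i, i ∈ I ↔
      (Finset.univ.filter fun x => H.Adj (extensionTip u t i) x).card < c := fun i => by
    simp [hIdef]
  have htriv : ∀ i, i ∉ I → t i = [] := fun i hi => by
    by_contra h
    exact hi ((hmem i).2 (he.card_nbrs_lt_of_ne_nil hb h))
  have hlt : ∀ i, i ∉ I → (missedPaths H u t i).card < (headNbrs H u t i).card := fun i hi => by
    have := he.card_nbrs_add_card_missedPaths_lt (htriv i hi)
    rw [hmem, not_lt] at hi
    omega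
  have hI : ∀ i, i ∉ I → i + 1 ∈ I := fun i hi => by
    by_contra hi'
    have h1 := he.card_headNbrs_le hb (htriv i hi)
    have h2 := he.card_headNbrs_succ_le hb (htriv _ hi')
    have := hlt _ hi
    have := hlt _ hi'
    omega
  obtain ⟨i₀, h₀, h₁⟩ : ∃ i₀ ∈ I, i₀ + 1 ∈ I := by
    by_contra! hno
    have hne : Iᶜ.Nonempty := by
      by_contra h
      rw [Finset.not_nonempty_iff_eq_empty, Finset.compl_eq_empty_iff] at h
      exact hno 0 (by simp [h]) (by simp [h])
    obtain ⟨i, hi, hle⟩ := he.exists_card_headNbrs_le hb hne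
      (fun i hi => htriv i (Finset.mem_compl.1 hi))
      (fun i hi => Finset.mem_compl.2 (hno i (by simpa using hi)))
    exact absurd (hlt i (Finset.mem_compl.1 hi)) (not_lt.2 hle)
  refine ⟨I, extensionTip u t, cellWeight I i₀, sum_cellWeight hI h₀, fun i => (hmem i).1, ?_⟩
  intro U hU U' hU' hne hne'
  obtain ⟨a, ha, b, hb', hle⟩ := exists_arc h₁ hU hU' hne hne'
  refine ⟨a, ha, b, hb', ?_⟩
  rcases eq_or_ne a b with rfl | hab
  · exact ⟨_, .singleton _, by simpa using hle⟩
  rcases le_total (b - a).val (a - b).val with h | h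
  · obtain ⟨l, hl, hlen⟩ := he.exists_path_tip hab.symm
    refine ⟨_, hl.reverse, ?_⟩
    rw [max_eq_right h] at hle
    simp only [List.length_reverse]
    omega
  · obtain ⟨l, hl, hlen⟩ := he.exists_path_tip hab
    refine ⟨_, hl, ?_⟩
    rw [max_eq_left h] at hle
    omega

theorem SimpleGraph.Walk.IsCycle.exists_cyclic_seq {V : Type*} {G : SimpleGraph V} {a : V}
    {p : G.Walk a a} (hp : p.IsCycle) :
    ∃ w : ZMod p.length → V, Function.Injective w ∧ (∀ i, G.Adj (w i) (w (i + 1))) ∧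
      ∀ x, x ∈ p.support ↔ ∃ i, w i = x := by
  have h3 := hp.three_le_length
  have : NeZero p.length := ⟨by omega⟩
  have hval : ∀ n, n < p.length → ((n : ZMod p.length)).val = n := fun n hn =>
    ZMod.val_cast_of_lt hn
  refine ⟨fun i => p.getVert i.val, ?_, fun i => ?_, fun x => ?_⟩
  · intro i j h
    have hi := ZMod.val_lt i
    have hj := ZMod.val_lt j
    exact ZMod.val_injective _ (hp.getVert_injOn' (by simp; omega) (by simp; omega) h)
  · have hi := ZMod.val_lt i
    have h := p.adj_getVert_succ hi
    have e : ((i.val + 1 : ℕ) : ZMod p.length) = i + 1 := by push_cast; simp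
    rcases Nat.lt_or_ge (i.val + 1) p.length with hlt | hge
    · have : (i + 1).val = i.val + 1 := by rw [← e, hval _ hlt]
      simpa [this] using h
    · have h' : i.val + 1 = p.length := by omega
      have : i + 1 = 0 := by rw [← e, h']; simp
      rw [h', p.getVert_length] at h
      simpa [this] using h
  · rw [Walk.mem_support_iff_exists_getVert]
    constructor
    · rintro ⟨n, rfl, hn⟩
      rcases hn.lt_or_eq with hn | rfl
      · exact ⟨n, congrArg p.getVert (hval n hn)⟩
      · exact ⟨0, by simp⟩
    · rintro ⟨i, rfl⟩
      exact ⟨i.val, rfl, (ZMod.val_lt i).le⟩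

section cbar

variable {W : Type*} (H : SimpleGraph W)

theorem cbar_eq_zero [IsEmpty W] : cbar H = 0 := by
  refine (congrArg sSup (Set.eq_empty_iff_forall_notMem.2 ?_)).trans csSup_empty
  rintro n (⟨-, ⟨x⟩⟩ | ⟨-, x, -⟩ | ⟨x, -⟩) <;> exact isEmptyElim x

variable [Fintype W]

theorem bddAbove_cycle_lengths : BddAbove {n : ℕ | (n = 1 ∧ Nonempty W) ∨
    (n = 2 ∧ ∃ u v : W, H.Adj u v) ∨ ∃ (v : W) (c : H.Walk v v), c.IsCycle ∧ c.length = n} := by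
  refine ⟨Fintype.card W + 2, ?_⟩
  rintro n (⟨rfl, -⟩ | ⟨rfl, -⟩ | ⟨v, p, hp, rfl⟩)
  · omega
  · omega
  · have := hp.support_nodup.length_le_card
    simp at this
    omega

theorem circumferenceLE_cbar : CircumferenceLE H (cbar H) := by
  refine ⟨fun a b h => ?_, fun a b l hl hadj h3 => ?_⟩
  · exact le_csSup (bddAbove_cycle_lengths H) (Or.inr (Or.inl ⟨rfl, a, b, h⟩))
  · obtain ⟨p, hp, hlen⟩ := hl.exists_cycle hadj h3
    exact le_csSup (bddAbove_cycle_lengths H) (Or.inr (Or.inr ⟨b, p, hp, hlen⟩))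

theorem exists_cyclic_seq_cbar [Nonempty W] : 0 < cbar H ∧ ∃ u : ZMod (cbar H) → W,
    Function.Injective u ∧ (2 ≤ cbar H → ∀ i, H.Adj (u i) (u (i + 1))) := by
  have hmem := Nat.sSup_mem (s := {n : ℕ | (n = 1 ∧ Nonempty W) ∨ (n = 2 ∧ ∃ u v : W, H.Adj u v) ∨
    ∃ (v : W) (c : H.Walk v v), c.IsCycle ∧ c.length = n}) ⟨1, Or.inl ⟨rfl, inferInstance⟩⟩
    (bddAbove_cycle_lengths H)
  change _ ∈ {n : ℕ | _} at hmem
  change (cbar H = 1 ∧ _) ∨ (cbar H = 2 ∧ _) ∨ ∃ (v : W) (c : H.Walk v v), c.IsCycle ∧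
    c.length = cbar H at hmem
  generalize cbar H = n at hmem ⊢
  rcases hmem with ⟨rfl, ⟨x⟩⟩ | ⟨rfl, x, y, hxy⟩ | ⟨v, p, hp, rfl⟩
  · exact ⟨by omega, fun _ => x, fun _ _ _ => Subsingleton.elim _ _, by omega⟩
  · refine ⟨by omega, fun i : Fin 2 => if i = 0 then x else y, ?_, fun _ => ?_⟩
    · have hne := hxy.ne
      intro i j h
      change Fin 2 at i j
      fin_cases i <;> fin_cases j <;> first | rfl | simp_all
    · intro i
      change Fin 2 at i
      fin_cases i
      · exact hxy
      · exact hxy.symm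
  · obtain ⟨w, hw, hadj, -⟩ := hp.exists_cyclic_seq
    exact ⟨by have := hp.three_le_length; omega, w, hw, fun _ => hadj⟩

end cbar

open scoped Classical in
/-- A cycle whose length `N` is the circumference of `G` is long in terms of the minimum degree
and of the circumference `c` of its complement. -/
theorem succ_mul_succ_le {V : Type*} [Fintype V] {G : SimpleGraph V} {N c δ : ℕ} [NeZero N]
    [NeZero c] {w : ZMod N → V} (hw : Function.Injective w)
    (hadj : ∀ i, G.Adj (w i) (w (i + 1))) (hN : 2 ≤ N) (hb : CircumferenceLE G N) {S : Set V}
    (hS : ∀ x, x ∈ S ↔ ∀ i, w i ≠ x)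
    (hδ : ∀ x, δ ≤ (Finset.univ.filter fun y => G.Adj x y).card) {u : ZMod c → S}
    (hu : Function.Injective u) (huadj : 2 ≤ c → ∀ i, (G.induce S).Adj (u i) (u (i + 1)))
    (huc : CircumferenceLE (G.induce S) c) : (c + 1) * (δ + 1) ≤ N + c * (c + 1) := by
  obtain ⟨I, v, y, hy, hv, hpath⟩ := exists_weighted_tips hu huadj huc
  have hsum : ∑ k : ZMod N, ∑ i ∈ I.filter (fun i => G.Adj (w k) (v i)), y i ≤ N := by
    refine sum_le_of_spaced _ fun p r hr hrN hp hq => ?_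
    obtain ⟨a, ha, b, hb', l, hl, hle⟩ := hpath _ (Finset.filter_subset _ _) _
      (Finset.filter_subset _ _) (Finset.nonempty_of_sum_ne_zero hp.ne')
      (Finset.nonempty_of_sum_ne_zero hq.ne')
    refine hle.trans (Nat.mul_le_mul_left _ ?_)
    have ha := (Finset.mem_filter.1 ha).2
    have hb' := (Finset.mem_filter.1 hb').2
    have hP := isPathList_cyclicArc (i := p + (r : ZMod N)) (n := N - r) hw (fun _ => hadj)
      (by omega)
    have e : p + (r : ZMod N) + ((N - r : ℕ) : ZMod N) = p := by
      rw [Nat.cast_sub hrN]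
      simp
    rw [e] at hP
    have hQ := hP.append (hl.map Subtype.val Subtype.val_injective fun _ _ h => h) ha (by
      intro x hx hx'
      obtain ⟨k, rfl⟩ := exists_of_mem_cyclicArc hx
      obtain ⟨z, -, hz⟩ := List.mem_map.1 hx'
      exact (hS z).1 z.2 k hz.symm)
    have := hb.2 _ _ _ hQ hb'.symm
    have := hl.length_pos
    simp only [List.length_append, length_cyclicArc, List.length_map] at *
    omega
  have hdeg : ∀ i ∈ I, δ + 1 ≤ (Finset.univ.filter fun k => G.Adj (w k) (v i)).card + c := by
    intro i hi
    have hsub : (Finset.univ.filter fun x => G.Adj (v i) x) ⊆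
        (Finset.univ.filter fun k => G.Adj (w k) (v i)).image w ∪
          (Finset.univ.filter fun x => (G.induce S).Adj (v i) x).image Subtype.val := by
      intro x hx
      have hx := (Finset.mem_filter.1 hx).2
      rw [Finset.mem_union, Finset.mem_image, Finset.mem_image]
      by_cases hxS : x ∈ S
      · exact Or.inr ⟨⟨x, hxS⟩, by simpa using hx, rfl⟩
      · rw [hS] at hxS
        push Not at hxS
        obtain ⟨k, rfl⟩ := hxS
        exact Or.inl ⟨k, by simpa using hx.symm, rfl⟩
    have h1 := (hδ (v i)).trans ((Finset.card_le_card hsub).trans (Finset.card_union_le _ _))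
    have h2 := Finset.card_image_le (s := Finset.univ.filter fun k => G.Adj (w k) (v i)) (f := w)
    have h3 := Finset.card_image_le
      (s := Finset.univ.filter fun x => (G.induce S).Adj (v i) x) (f := Subtype.val)
    have h4 : (Finset.univ.filter fun x => (G.induce S).Adj (v i) x).card < c := by
      convert hv i hi
    omega
  have hswap : ∑ k : ZMod N, ∑ i ∈ I.filter (fun i => G.Adj (w k) (v i)), y i =
      ∑ i ∈ I, y i * (Finset.univ.filter fun k => G.Adj (w k) (v i)).card := by
    simp only [Finset.sum_filter]
    rw [Finset.sum_comm]
    refine Finset.sum_congr rfl fun i _ => ?_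
    rw [← Finset.sum_filter, Finset.sum_const, smul_eq_mul, mul_comm]
  calc (c + 1) * (δ + 1) = ∑ i ∈ I, y i * (δ + 1) := by rw [← hy, Finset.sum_mul]
    _ ≤ ∑ i ∈ I, (y i * (Finset.univ.filter fun k => G.Adj (w k) (v i)).card + y i * c) :=
      Finset.sum_le_sum fun i hi => by
        rw [← mul_add]
        exact Nat.mul_le_mul_left _ (hdeg i hi)
    _ = _ + (c + 1) * c := by rw [Finset.sum_add_distrib, ← Finset.sum_mul, hy]
    _ ≤ N + c * (c + 1) := by rw [mul_comm c]; omega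

theorem IsLongestCycle.succ_cbar_mul_le {V : Type*} [Fintype V] {G : SimpleGraph V}
    [DecidableRel G.Adj] {v : V} {C : G.Walk v v} (hC : IsLongestCycle G C) :
    ((cbar (G.induce {x : V | x ∉ C.support}) : ℤ) + 1) *
        (G.minDegree - cbar (G.induce {x : V | x ∉ C.support}) + 2) ≤ Fintype.card V + 1 := by
  classical
  rcases isEmpty_or_nonempty {x : V | x ∉ C.support} with hE | hE
  · rw [cbar_eq_zero]
    have : Nonempty V := ⟨v⟩
    have := G.minDegree_lt_card
    push_cast
    omega
  obtain ⟨hpos, u, hu, huadj⟩ := exists_cyclic_seq_cbar (G.induce {x : V | x ∉ C.support})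
  have huc := circumferenceLE_cbar (G.induce {x : V | x ∉ C.support})
  generalize cbar (G.induce {x : V | x ∉ C.support}) = c at *
  have hc : NeZero c := ⟨hpos.ne'⟩
  have h3 := hC.1.three_le_length
  obtain ⟨w, hw, hadj, hsupp⟩ := hC.1.exists_cyclic_seq
  have hN : NeZero C.length := ⟨by omega⟩
  have hb : CircumferenceLE G C.length := by
    refine ⟨fun _ _ _ => by omega, fun a b l hl hab hl3 => ?_⟩
    obtain ⟨p, hp, hlen⟩ := hl.exists_cycle hab hl3
    exact hlen ▸ hC.2 _ p hp
  have hmain := succ_mul_succ_le (δ := G.minDegree) hw hadj (by omega) hb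
    (S := {x : V | x ∉ C.support}) (fun x => by simp [hsupp x])
    (fun x => (G.minDegree_le_degree x).trans_eq (by
      rw [← G.card_neighborFinset_eq_degree]
      congr 1
      ext y
      simp)) hu huadj huc
  have hcard : C.length + c ≤ Fintype.card V := by
    have hinj : Function.Injective (Sum.elim w fun i => (u i : V)) := by
      refine hw.sumElim (Subtype.val_injective.comp hu) fun i j h => ?_
      exact (u j).2 ((hsupp _).2 ⟨i, h⟩)
    simpa using Fintype.card_le_of_injective _ hinj
  zify at hmain hcard
  linarith

/-- Theorem 3: if `δ ≥ (n+2)/(l+1) + l - 2` then a longest cycle `C` satisfies either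
`c̄ ≤ min (l-1) (δ-l)` or `c̄ ≥ max (l+1) (δ-l+2)`. -/
theorem stmt_2 {V : Type*} [Fintype V] [DecidableEq V] (G : SimpleGraph V)
    [DecidableRel G.Adj] (l : ℕ) (hl : 1 ≤ l)
    {v : V} (C : G.Walk v v) (hC : IsLongestCycle G C)
    (hdeg : (G.minDegree : ℝ) ≥ ((Fintype.card V : ℝ) + 2) / ((l : ℝ) + 1) + (l : ℝ) - 2) :
    (cbar (G.induce {x : V | x ∉ C.support}) : ℤ) ≤
        min ((l : ℤ) - 1) ((G.minDegree : ℤ) - (l : ℤ)) ∨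
      (cbar (G.induce {x : V | x ∉ C.support}) : ℤ) ≥
        max ((l : ℤ) + 1) ((G.minDegree : ℤ) - (l : ℤ) + 2) := by
  have key := hC.succ_cbar_mul_le
  generalize cbar (G.induce {x : V | x ∉ C.support}) = c at *
  have hl' : (0 : ℝ) < (l : ℝ) + 1 := by positivity
  have h1 : ((Fintype.card V : ℝ) + 2) / ((l : ℝ) + 1) ≤ (G.minDegree : ℝ) - l + 2 := by linarith
  rw [div_le_iff₀ hl'] at h1
  have h2 : (Fintype.card V : ℤ) + 2 ≤ ((G.minDegree : ℤ) - l + 2) * (l + 1) := by exact_mod_cast h1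
  have h3 : 0 < ((l : ℤ) - c) * (G.minDegree + 1 - c - l) := by linarith
  rw [le_min_iff, ge_iff_le, max_le_iff]
  rcases pos_and_pos_or_neg_and_neg_of_mul_pos h3 with h | h
  · left
    constructor <;> omega
  · right
    constructor <;> omega
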